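/- arXiv:cs/0310043 — 4 statements merged into one kernel-verified Lean document; each statement's English description precedes it below -/
import Mathlib

section
/- Let n ≥ 1 and m ≥ 0 be integers. Let weights w_p ∈ ℝ and nodes u_p ∈ ℝⁿ be given for each multi-index p ∈ ℕⁿ with |p| = m. Suppose that for every multi-index k ∈ ℕⁿ whose components are all even and with |k| ≤ 2m, the rule is exact: Σ_{|p|=m} w_p · (z ↦ Π_i z_i^{k_i}){u_p} = ∫_{S^{n−1}} Π_i ξ_i^{k_i} dσ(ξ). Then for EVERY multi-index k ∈ ℕⁿ with |k| ≤ 2m+1 one has Σ_{|p|=m} w_p · (z ↦ Π_i z_i^{k_i}){u_p} = ∫_{S^{n−1}} Π_i ξ_i^{k_i} dσ(ξ); consequently the rule f ↦ Σ_{|p|=m} w_p f{u_p} integrates exactly over S^{n−1} every polynomial f of total degree at most 2m+1. -/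
open MeasureTheory

/-- The symmetric sum f{u} := 2^{−n} Σ_{s ∈ {−1,1}ⁿ} f(s₁u₁, …, sₙuₙ). -/
noncomputable def symmSum (n : ℕ) (f : (Fin n → ℝ) → ℝ) (u : Fin n → ℝ) : ℝ :=
  (2 : ℝ) ^ (-(n : ℤ)) * ∑ s : Fin n → ℤˣ, f (fun i => ((s i : ℤ) : ℝ) * u i)

open scoped Pointwise in
/-- A measure preserving linear isometric equivalence restricts to a measure preserving self-map
of the unit sphere. -/
theorem measurePreserving_sphere_toSphere {E : Type*} [NormedAddCommGroup E] [NormedSpace ℝ E]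
    [MeasurableSpace E] [BorelSpace E] {μ : Measure E} (e : E ≃ₗᵢ[ℝ] E)
    (he : MeasurePreserving e μ μ)
    (h : ∀ x, x ∈ Metric.sphere (0 : E) 1 → e x ∈ Metric.sphere (0 : E) 1) :
    MeasurePreserving (Subtype.map e h) μ.toSphere μ.toSphere := by
  have hT : Measurable (Subtype.map e h) := (e.continuous.subtype_map h).measurable
  refine ⟨hT, Measure.ext fun s hs => ?_⟩
  have hpre : Set.Ioo (0 : ℝ) 1 • ((↑) '' (Subtype.map e h ⁻¹' s) : Set E) =
      e ⁻¹' (Set.Ioo (0 : ℝ) 1 • ((↑) '' s)) := by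
    ext x
    simp only [Set.mem_smul, Set.mem_image, Set.mem_preimage]
    constructor
    · rintro ⟨r, hr, _, ⟨y, hy, rfl⟩, rfl⟩
      exact ⟨r, hr, _, ⟨_, hy, rfl⟩, (map_smul e r (y : E)).symm⟩
    · rintro ⟨r, hr, _, ⟨y, hy, rfl⟩, hx⟩
      have hy' : e.symm y ∈ Metric.sphere (0 : E) 1 := by simp
      refine ⟨r, hr, _, ⟨⟨e.symm y, hy'⟩, ?_, rfl⟩, ?_⟩
      · convert hy
        exact Subtype.ext (e.apply_symm_apply y)
      · rw [← map_smul, hx, e.symm_apply_apply]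
  rw [Measure.map_apply hT hs, Measure.toSphere_apply' μ (hT hs), Measure.toSphere_apply' μ hs,
    hpre, he.measure_preimage_emb e.toHomeomorph.measurableEmbedding]

/-- Flipping the sign of a coordinate with odd exponent negates a monomial. -/
theorem prod_pow_update_neg_one {n : ℕ} {k : Fin n → ℕ} {i : Fin n} (hi : Odd (k i))
    (z : Fin n → ℝ) :
    ∏ j, (if j = i then -z j else z j) ^ k j = -∏ j, z j ^ k j := by
  rw [← Finset.mul_prod_erase _ _ (Finset.mem_univ i),
    ← Finset.mul_prod_erase _ (fun j => z j ^ k j) (Finset.mem_univ i), ← neg_mul, if_pos rfl,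
    hi.neg_pow]
  congr 1
  exact Finset.prod_congr rfl fun j hj => by rw [if_neg (Finset.ne_of_mem_erase hj)]

theorem symmSum_prod_pow_eq_zero {n : ℕ} {k : Fin n → ℕ} {i : Fin n} (hi : Odd (k i))
    (u : Fin n → ℝ) : symmSum n (fun z => ∏ j, z j ^ k j) u = 0 := by
  unfold symmSum
  refine mul_eq_zero_of_right _ (self_eq_neg.mp ?_)
  rw [← Finset.sum_neg_distrib,
    ← Equiv.sum_comp (Equiv.mulRight (fun j => if j = i then -1 else 1 : Fin n → ℤˣ))]
  refine Finset.sum_congr rfl fun s _ => ?_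
  rw [← prod_pow_update_neg_one hi]
  refine Finset.prod_congr rfl fun j _ => ?_
  by_cases hj : j = i <;> simp [hj]

theorem continuous_sphere_prod_pow {n : ℕ} (k : Fin n → ℕ) :
    Continuous fun ξ : Metric.sphere (0 : EuclideanSpace ℝ (Fin n)) 1 =>
      ∏ i, (ξ : EuclideanSpace ℝ (Fin n)) i ^ k i := by
  fun_prop

theorem integral_sphere_prod_pow_eq_zero {n : ℕ} {k : Fin n → ℕ} {i : Fin n} (hi : Odd (k i)) :
    ∫ ξ : Metric.sphere (0 : EuclideanSpace ℝ (Fin n)) 1,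
        ∏ j, (ξ : EuclideanSpace ℝ (Fin n)) j ^ k j
      ∂((volume : Measure (EuclideanSpace ℝ (Fin n))).toSphere) = 0 := by
  let e : EuclideanSpace ℝ (Fin n) ≃ₗᵢ[ℝ] EuclideanSpace ℝ (Fin n) :=
    LinearIsometryEquiv.piLpCongrRight 2 fun j =>
      if j = i then LinearIsometryEquiv.neg ℝ else LinearIsometryEquiv.refl ℝ ℝ
  have hcoord : ∀ x j, e x j = if j = i then -x j else x j := fun x j => by
    by_cases hj : j = i <;> simp [e, hj]
  have hmp := measurePreserving_sphere_toSphere e e.measurePreserving (fun x hx => by simpa using hx)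
  refine self_eq_neg.mp ?_
  conv_lhs => rw [← hmp.map_eq]
  rw [integral_map hmp.measurable.aemeasurable
    (continuous_sphere_prod_pow k).aestronglyMeasurable, ← integral_neg]
  refine integral_congr_ae (.of_forall fun ξ => ?_)
  simp only [Subtype.map_coe, hcoord]
  exact prod_pow_update_neg_one hi _

theorem symmSum_eval {n : ℕ} (f : MvPolynomial (Fin n) ℝ) (u : Fin n → ℝ) :
    symmSum n (fun z => MvPolynomial.eval z f) u =
      ∑ d ∈ f.support, f.coeff d * symmSum n (fun z => ∏ i, z i ^ d i) u := by
  simp only [symmSum, MvPolynomial.eval_eq', Finset.mul_sum]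
  rw [Finset.sum_comm]
  exact Finset.sum_congr rfl fun d _ => Finset.sum_congr rfl fun s _ => by ring

/-- if the rule Σ_{|p|=m} w_p f{u_p} is exact on S^{n−1} for every monomial
whose multi-index has all components even and total degree ≤ 2m, then it is exact for
every monomial of total degree ≤ 2m+1, and consequently for every polynomial of total
degree at most 2m+1.  Here σ is the surface measure `volume.toSphere` on the unit
sphere of ℝⁿ. -/
theorem symmetric_rule_polynomial_degree
    (n m : ℕ) (hn : 1 ≤ n)
    (w : (Fin n → ℕ) → ℝ) (u : (Fin n → ℕ) → (Fin n → ℝ))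
    (hexact : ∀ k : Fin n → ℕ, (∀ i, Even (k i)) → (∑ i, k i) ≤ 2 * m →
      (∑ p ∈ Finset.Nat.antidiagonalTuple n m,
          w p * symmSum n (fun z => ∏ i, z i ^ k i) (u p))
        = ∫ ξ : Metric.sphere (0 : EuclideanSpace ℝ (Fin n)) 1,
            ∏ i, (ξ : EuclideanSpace ℝ (Fin n)) i ^ k i
          ∂((volume : Measure (EuclideanSpace ℝ (Fin n))).toSphere)) :
    (∀ k : Fin n → ℕ, (∑ i, k i) ≤ 2 * m + 1 →
      (∑ p ∈ Finset.Nat.antidiagonalTuple n m,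
          w p * symmSum n (fun z => ∏ i, z i ^ k i) (u p))
        = ∫ ξ : Metric.sphere (0 : EuclideanSpace ℝ (Fin n)) 1,
            ∏ i, (ξ : EuclideanSpace ℝ (Fin n)) i ^ k i
          ∂((volume : Measure (EuclideanSpace ℝ (Fin n))).toSphere)) ∧
    (∀ f : MvPolynomial (Fin n) ℝ, f.totalDegree ≤ 2 * m + 1 →
      (∑ p ∈ Finset.Nat.antidiagonalTuple n m,
          w p * symmSum n (fun z => MvPolynomial.eval z f) (u p))
        = ∫ ξ : Metric.sphere (0 : EuclideanSpace ℝ (Fin n)) 1,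
            MvPolynomial.eval (fun i => (ξ : EuclideanSpace ℝ (Fin n)) i) f
          ∂((volume : Measure (EuclideanSpace ℝ (Fin n))).toSphere)) := by
  have hmono : ∀ k : Fin n → ℕ, (∑ i, k i) ≤ 2 * m + 1 →
      (∑ p ∈ Finset.Nat.antidiagonalTuple n m,
          w p * symmSum n (fun z => ∏ i, z i ^ k i) (u p))
        = ∫ ξ : Metric.sphere (0 : EuclideanSpace ℝ (Fin n)) 1,
            ∏ i, (ξ : EuclideanSpace ℝ (Fin n)) i ^ k i
          ∂((volume : Measure (EuclideanSpace ℝ (Fin n))).toSphere) := by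
    intro k hk
    by_cases heven : ∀ i, Even (k i)
    · obtain ⟨r, hr⟩ := Finset.even_sum (s := Finset.univ) k fun i _ => heven i
      exact hexact k heven (by omega)
    · obtain ⟨i, hi⟩ := not_forall.mp heven
      rw [Nat.not_even_iff_odd] at hi
      rw [integral_sphere_prod_pow_eq_zero hi]
      simp [symmSum_prod_pow_eq_zero hi]
  refine ⟨hmono, fun f hf => ?_⟩
  simp only [symmSum_eval, Finset.mul_sum]
  simp only [MvPolynomial.eval_eq']
  rw [Finset.sum_comm, integral_finsetSum]
  · refine Finset.sum_congr rfl fun d hd => ?_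
    rw [integral_const_mul, ← hmono d, Finset.mul_sum]
    · exact Finset.sum_congr rfl fun p _ => mul_left_comm _ _ _
    · have hdeg := MvPolynomial.le_totalDegree hd
      rw [Finsupp.sum_fintype _ _ fun _ => rfl] at hdeg
      exact hdeg.trans hf
  · exact fun d _ => ((continuous_sphere_prod_pow d).integrable_of_hasCompactSupport
      (.of_compactSpace _)).const_mul _
end

section
/- Let g : ℝ → [0,∞) be measurable, let A be an invertible real n×n matrix, let μ ∈ ℝⁿ, and set Σ = A Aᵗ. Then the pushforward under the affine map y ↦ Ay + μ of the measure on ℝⁿ with Lebesgue density y ↦ g(yᵗy) equals the measure with Lebesgue density x ↦ g((x − μ)ᵗ Σ⁻¹ (x − μ)) / √(det Σ). In particular, if a random vector Y has spherical density y ↦ g(‖y‖²) then X = AY + μ has the elliptic density h(x) = g((x − μ)ᵗ Σ⁻¹ (x − μ)) / √(det Σ). -/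
open MeasureTheory Matrix
open scoped RealInnerProductSpace NNReal ENNReal

theorem MeasureTheory.Measure.map_withDensity_comp {α β : Type*} [MeasurableSpace α]
    [MeasurableSpace β] (ν : Measure α) {f : α → β} (hf : Measurable f) {h : β → ℝ≥0∞}
    (hh : Measurable h) :
    (ν.withDensity (h ∘ f)).map f = (ν.map f).withDensity h := by
  ext s hs
  rw [Measure.map_apply hf hs, withDensity_apply _ (hf hs), withDensity_apply _ hs,
    setLIntegral_map hs hh hf]
  rfl

/-- For `Σ = A Aᵗ` with `A` invertible, `(A y)ᵗ Σ⁻¹ (A y) = yᵗ y`. -/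
theorem Matrix.inner_toEuclideanLin_mul_transpose_inv {ι : Type*} [Fintype ι] [DecidableEq ι]
    (A : Matrix ι ι ℝ) (hA : IsUnit A.det) (y : EuclideanSpace ℝ ι) :
    ⟪Matrix.toEuclideanLin A y,
      Matrix.toEuclideanLin (A * Aᵀ)⁻¹ (Matrix.toEuclideanLin A y)⟫ = ⟪y, y⟫ := by
  have hAt : IsUnit Aᵀ.det := by rwa [det_transpose]
  have hM : Aᵀ * ((A * Aᵀ)⁻¹ * A) = 1 := by
    rw [mul_inv_rev, Matrix.mul_assoc, nonsing_inv_mul A hA, Matrix.mul_one,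
      mul_nonsing_inv _ hAt]
  simp only [EuclideanSpace.inner_eq_star_dotProduct, toLpLin_apply, star_trivial,
    mulVec_mulVec]
  rw [dotProduct_mulVec, ← mulVec_transpose, mulVec_mulVec, hM, one_mulVec]

/-- The affine map `y ↦ A y + b` scales Lebesgue measure by `1 / √(det (A Aᵗ))`. -/
theorem Matrix.map_toEuclideanLin_add_volume {ι : Type*} [Fintype ι] [DecidableEq ι]
    (A : Matrix ι ι ℝ) (hA : IsUnit A.det) (b : EuclideanSpace ℝ ι) :
    (volume : Measure (EuclideanSpace ℝ ι)).map (fun y => Matrix.toEuclideanLin A y + b)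
      = (ENNReal.ofReal √(A * Aᵀ).det)⁻¹ • volume := by
  have hdet : LinearMap.det (Matrix.toEuclideanLin A) = A.det := by
    rw [toEuclideanLin_eq_toLin_orthonormal, LinearMap.det_toLin]
  have hlin : Measurable (Matrix.toEuclideanLin A) :=
    (LinearMap.continuous_of_finiteDimensional _).measurable
  change Measure.map ((· + b) ∘ Matrix.toEuclideanLin A) volume = _
  rw [← Measure.map_map (measurable_add_const b) hlin,
    Measure.map_linearMap_addHaar_eq_smul_addHaar _ (hdet ▸ hA.ne_zero), Measure.map_smul,
    map_add_right_eq_self, hdet, det_mul, det_transpose, Real.sqrt_mul_self_eq_abs, abs_inv,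
    ENNReal.ofReal_inv_of_pos (abs_pos.2 hA.ne_zero)]

/-- pushforward of the spherical density y ↦ g(yᵗy) under the affine map
y ↦ Ay + μ (A invertible, Σ = AAᵗ) is the elliptic density
x ↦ g((x−μ)ᵗ Σ⁻¹ (x−μ)) / √(det Σ).  Quadratic forms are expressed via the real inner
product on Euclidean space: yᵗy = ⟪y, y⟫ and xᵗ M x = ⟪x, M x⟫. -/
theorem map_affine_spherical_density_eq_elliptic_density
    (n : ℕ) (g : ℝ → ℝ≥0) (hg : Measurable g)
    (A : Matrix (Fin n) (Fin n) ℝ) (hA : IsUnit A.det)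
    (μ : EuclideanSpace ℝ (Fin n)) :
    Measure.map (fun y : EuclideanSpace ℝ (Fin n) => Matrix.toEuclideanLin A y + μ)
        (volume.withDensity fun y : EuclideanSpace ℝ (Fin n) => (g ⟪y, y⟫ : ℝ≥0∞))
      = volume.withDensity fun x : EuclideanSpace ℝ (Fin n) =>
          (g ⟪x - μ, Matrix.toEuclideanLin (A * Aᵀ)⁻¹ (x - μ)⟫ : ℝ≥0∞)
            / ENNReal.ofReal (Real.sqrt (A * Aᵀ).det) := by
  have hh : Measurable fun x : EuclideanSpace ℝ (Fin n) =>
      (g ⟪x - μ, Matrix.toEuclideanLin (A * Aᵀ)⁻¹ (x - μ)⟫ : ℝ≥0∞) := by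
    have hlin := LinearMap.continuous_of_finiteDimensional (Matrix.toEuclideanLin (A * Aᵀ)⁻¹)
    have hq : Continuous fun x : EuclideanSpace ℝ (Fin n) =>
        ⟪x - μ, Matrix.toEuclideanLin (A * Aᵀ)⁻¹ (x - μ)⟫ := by fun_prop
    exact (hg.comp hq.measurable).coe_nnreal_ennreal
  have hf : Measurable fun y : EuclideanSpace ℝ (Fin n) => Matrix.toEuclideanLin A y + μ :=
    (LinearMap.continuous_of_finiteDimensional _).measurable.add_const μ
  have key := Measure.map_withDensity_comp volume hf hh
  simp only [Function.comp_def, add_sub_cancel_right,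
    A.inner_toEuclideanLin_mul_transpose_inv hA] at key
  rw [key, A.map_toEuclideanLin_add_volume hA, withDensity_smul_measure,
    ← withDensity_smul _ hh]
  congr 1 with x
  simp only [Pi.smul_apply, smul_eq_mul, div_eq_mul_inv, mul_comm]
end

section
/- Let n ≥ 1 be an integer, ν > 0, j ∈ ℕ with j + 1 < n + ν, a > 0, and b₁ ∈ ℝ with b₁ < ν. Let t₀ > 0 satisfy a t₀² > ν − b₁. Then the Student-t tail moment integral evaluates in closed form: ∫_{t₀}^∞ u^j (1 + (a u² − b₁)/ν)^{−(n+ν)/2} du = (ν^{(n+ν)/2} a^{−(n+ν)/2} t₀^{\,j+1−n−ν} / (n + ν − j − 1)) · ₂F₁( (n+ν)/2, (n+ν−j−1)/2 ; (n+ν−j+1)/2 ; (b₁ − ν)/(a t₀²) ), where the hypergeometric series converges since |(b₁ − ν)/(a t₀²)| < 1. -/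
open MeasureTheory

/-- The Gauss hypergeometric function ₂F₁(a, b; c; z), defined by its power series
Σ_{k≥0} (a)_k (b)_k / ((c)_k k!) · z^k, where (a)_k is the Pochhammer rising factorial. -/
noncomputable def hyp2F1 (a b c z : ℝ) : ℝ :=
  ∑' k : ℕ, ((ascPochhammer ℝ k).eval a * (ascPochhammer ℝ k).eval b
      / ((ascPochhammer ℝ k).eval c * (k.factorial : ℝ))) * z ^ k

theorem ascPochhammer_eval_mul_add (b : ℝ) (k : ℕ) :
    (ascPochhammer ℝ k).eval b * (b + k) = b * (ascPochhammer ℝ k).eval (b + 1) := by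
  induction k with
  | zero => simp
  | succ k ih =>
    rw [ascPochhammer_succ_eval, ascPochhammer_succ_eval, ih]
    push_cast
    ring

/-- The binomial series of `(1 - x) ^ (-s)` in terms of rising factorials. -/
theorem hasSum_ascPochhammer_one_sub_rpow_neg (s : ℝ) {x : ℝ} (hx : |x| < 1) :
    HasSum (fun k : ℕ => (ascPochhammer ℝ k).eval s / (k.factorial : ℝ) * x ^ k)
      ((1 - x) ^ (-s)) := by
  have h := (Real.one_div_one_sub_rpow_hasFPowerSeriesOnBall_zero s).hasSum (y := x)
    (by simpa [enorm_eq_nnnorm, ← NNReal.coe_lt_coe] using hx)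
  have hx' : 0 ≤ 1 - x := by linarith [le_abs_self x]
  rw [Real.rpow_neg hx']
  convert! h using 1
  · funext k
    have hk : (k.factorial : ℝ) ≠ 0 := by positivity
    have hc := Ring.factorial_nsmul_multichoose_eq_ascPochhammer s k
    rw [Polynomial.ascPochhammer_smeval_eq_eval, Ring.multichoose_eq, nsmul_eq_mul] at hc
    rw [FormalMultilinearSeries.ofScalars_apply_eq, ← hc, smul_eq_mul]
    field_simp
  · simp

theorem hyp2F1_coeff_add_one (s x : ℝ) {b : ℝ} (hb : 0 < b) (k : ℕ) :
    ((ascPochhammer ℝ k).eval s * (ascPochhammer ℝ k).eval b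
        / ((ascPochhammer ℝ k).eval (b + 1) * (k.factorial : ℝ))) * x ^ k
      = (ascPochhammer ℝ k).eval s / (k.factorial : ℝ) * x ^ k * (b / (b + k)) := by
  have h1 : (ascPochhammer ℝ k).eval (b + 1) ≠ 0 := (ascPochhammer_pos k _ (by linarith)).ne'
  have h2 : b + k ≠ 0 := by positivity
  have h3 : (k.factorial : ℝ) ≠ 0 := by positivity
  have h := ascPochhammer_eval_mul_add b k
  field_simp
  linear_combination (ascPochhammer ℝ k).eval s * x ^ k * h

theorem summable_hyp2F1_add_one (s : ℝ) {b x : ℝ} (hb : 0 < b) (hx : |x| < 1) :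
    Summable fun k : ℕ => ((ascPochhammer ℝ k).eval s * (ascPochhammer ℝ k).eval b
        / ((ascPochhammer ℝ k).eval (b + 1) * (k.factorial : ℝ))) * x ^ k := by
  refine (hasSum_ascPochhammer_one_sub_rpow_neg s hx).summable.abs.of_norm_bounded fun k => ?_
  rw [hyp2F1_coeff_add_one s x hb, norm_mul, Real.norm_eq_abs, Real.norm_eq_abs]
  refine mul_le_of_le_one_right (abs_nonneg _) ?_
  rw [abs_of_nonneg (by positivity)]
  exact div_le_one_of_le₀ (by linarith [k.cast_nonneg (α := ℝ)]) (by positivity)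

/-- Term-by-term integration of the binomial series of `(1 - w / u ^ 2) ^ (-s)` against a power
of `u` over a half-line. -/
theorem integral_Ioi_rpow_mul_one_sub_div_sq_rpow_neg (s : ℝ) {b t w : ℝ} (hb : 0 < b)
    (ht : 0 < t) (hw : |w| < t ^ 2) :
    ∫ u in Set.Ioi t, u ^ (-2 * b - 1) * (1 - w / u ^ 2) ^ (-s)
      = t ^ (-2 * b) / (2 * b) * hyp2F1 s b (b + 1) (w / t ^ 2) := by
  set c : ℕ → ℝ := fun k => (ascPochhammer ℝ k).eval s / (k.factorial : ℝ) with hc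
  set F : ℕ → ℝ → ℝ := fun k u => c k * w ^ k * u ^ (-2 * b - 1 - 2 * k) with hF
  have hlt : ∀ k : ℕ, -2 * b - 1 - 2 * k < -1 := fun k => by
    linarith [k.cast_nonneg (α := ℝ)]
  have hpow : ∀ (k : ℕ) (p : ℝ) {u : ℝ}, 0 < u → u ^ (p - 2 * k) = u ^ p / (u ^ 2) ^ k := by
    intro k p u hu
    rw [Real.rpow_sub hu, ← pow_mul, ← Real.rpow_natCast u (2 * k)]
    push_cast
    rfl
  have hpint : ∀ k : ℕ, ∫ u in Set.Ioi t, u ^ (-2 * b - 1 - 2 * k)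
      = t ^ (-2 * b) / (t ^ 2) ^ k / (2 * (b + k)) := by
    intro k
    rw [integral_Ioi_rpow_of_lt (hlt k) ht, ← hpow k _ ht,
      show -2 * b - 1 - 2 * (k : ℝ) + 1 = -2 * b - 2 * k by ring,
      show -2 * b - 2 * (k : ℝ) = -(2 * (b + k)) by ring, neg_div_neg_eq]
  have hint : ∀ k, IntegrableOn (F k) (Set.Ioi t) := fun k =>
    (integrableOn_Ioi_rpow_of_lt (hlt k) ht).const_mul _
  have hx : |w / t ^ 2| < 1 := by
    rw [abs_div, abs_of_pos (by positivity : 0 < t ^ 2)]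
    exact (div_lt_one (by positivity)).2 hw
  have hterm : ∀ k, ∫ u in Set.Ioi t, F k u = t ^ (-2 * b) / (2 * b) *
      (((ascPochhammer ℝ k).eval s * (ascPochhammer ℝ k).eval b
        / ((ascPochhammer ℝ k).eval (b + 1) * (k.factorial : ℝ))) * (w / t ^ 2) ^ k) := by
    intro k
    have h2 : b + k ≠ 0 := by positivity
    rw [hyp2F1_coeff_add_one s _ hb, integral_const_mul, hpint, hc, div_pow]
    field_simp
  have hsum := summable_hyp2F1_add_one s hb hx
  have hnorm : ∀ k, ∫ u in Set.Ioi t, ‖F k u‖ = ‖∫ u in Set.Ioi t, F k u‖ := by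
    intro k
    have hnn : 0 ≤ ∫ u in Set.Ioi t, u ^ (-2 * b - 1 - 2 * (k : ℝ)) :=
      setIntegral_nonneg measurableSet_Ioi fun u hu => Real.rpow_nonneg (ht.trans hu).le _
    rw [integral_const_mul, norm_mul, Real.norm_of_nonneg hnn, ← integral_const_mul]
    refine setIntegral_congr_fun measurableSet_Ioi fun u hu => ?_
    rw [norm_mul, Real.norm_of_nonneg (Real.rpow_nonneg (ht.trans hu).le _)]
  have hmain := integral_tsum_of_summable_integral_norm hint (by
    simp_rw [hnorm, hterm]
    exact (hsum.mul_left _).norm)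
  rw [hyp2F1, ← tsum_mul_left, ← tsum_congr hterm, hmain]
  refine setIntegral_congr_fun measurableSet_Ioi fun u hu => ?_
  have hu0 : 0 < u := ht.trans hu
  have hxu : |w / u ^ 2| < 1 := by
    rw [abs_div, abs_of_pos (by positivity : 0 < u ^ 2), div_lt_one (by positivity)]
    exact hw.trans (pow_lt_pow_left₀ hu ht.le two_ne_zero)
  change _ = ∑' k, F k u
  rw [← (hasSum_ascPochhammer_one_sub_rpow_neg s hxu).tsum_eq, ← tsum_mul_left]
  refine tsum_congr fun k => ?_
  simp only [hF, hc]
  rw [hpow k _ hu0, div_pow]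
  ring

/-- closed form of the Student-t tail moment: for n ≥ 1, ν > 0,
j + 1 < n + ν, a > 0, b₁ < ν and t₀ > 0 with at₀² > ν − b₁,
∫_{t₀}^∞ u^j (1 + (au² − b₁)/ν)^{−(n+ν)/2} du
  = (ν^{(n+ν)/2} a^{−(n+ν)/2} t₀^{j+1−n−ν} / (n+ν−j−1))
      · ₂F₁((n+ν)/2, (n+ν−j−1)/2; (n+ν−j+1)/2; (b₁−ν)/(at₀²)),
the hypergeometric series converging since |(b₁−ν)/(at₀²)| < 1. -/
theorem student_tail_moment_hypergeometric
    (n : ℕ) (hn : 1 ≤ n) (ν : ℝ) (hν : 0 < ν) (j : ℕ)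
    (hj : (j : ℝ) + 1 < (n : ℝ) + ν) (a : ℝ) (ha : 0 < a)
    (b₁ : ℝ) (hb₁ : b₁ < ν) (t₀ : ℝ) (ht₀ : 0 < t₀)
    (ht₀' : ν - b₁ < a * t₀ ^ 2) :
    (Summable fun k : ℕ =>
      ((ascPochhammer ℝ k).eval (((n : ℝ) + ν) / 2)
          * (ascPochhammer ℝ k).eval (((n : ℝ) + ν - j - 1) / 2)
          / ((ascPochhammer ℝ k).eval (((n : ℝ) + ν - j + 1) / 2) * (k.factorial : ℝ)))
        * ((b₁ - ν) / (a * t₀ ^ 2)) ^ k) ∧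
    ((∫ u in Set.Ioi t₀, u ^ j * (1 + (a * u ^ 2 - b₁) / ν) ^ (-(((n : ℝ) + ν) / 2)))
      = ν ^ (((n : ℝ) + ν) / 2) * a ^ (-(((n : ℝ) + ν) / 2))
          * t₀ ^ ((j : ℝ) + 1 - n - ν) / ((n : ℝ) + ν - j - 1)
          * hyp2F1 (((n : ℝ) + ν) / 2) (((n : ℝ) + ν - j - 1) / 2)
              (((n : ℝ) + ν - j + 1) / 2) ((b₁ - ν) / (a * t₀ ^ 2))) := by
  set s : ℝ := ((n : ℝ) + ν) / 2 with hs
  set b : ℝ := ((n : ℝ) + ν - j - 1) / 2 with hb_def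
  have hb : 0 < b := by rw [hb_def]; linarith
  have hb1 : ((n : ℝ) + ν - j + 1) / 2 = b + 1 := by rw [hb_def]; ring
  have hz : (b₁ - ν) / (a * t₀ ^ 2) = (b₁ - ν) / a / t₀ ^ 2 := by rw [div_div]
  have hw : |(b₁ - ν) / a| < t₀ ^ 2 := by
    rw [abs_div, abs_of_pos ha, abs_of_neg (by linarith), div_lt_iff₀ ha]
    linarith
  have hx : |(b₁ - ν) / a / t₀ ^ 2| < 1 := by
    rw [abs_div, abs_of_pos (by positivity : 0 < t₀ ^ 2)]
    exact (div_lt_one (by positivity)).2 hw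
  rw [hb1, hz]
  refine ⟨summable_hyp2F1_add_one s hb hx, ?_⟩
  rw [show (j : ℝ) + 1 - n - ν = -2 * b by rw [hb_def]; ring,
    show (n : ℝ) + ν - j - 1 = 2 * b by rw [hb_def]; ring, mul_div_assoc, mul_assoc,
    ← integral_Ioi_rpow_mul_one_sub_div_sq_rpow_neg s hb ht₀ hw, ← integral_const_mul]
  refine setIntegral_congr_fun measurableSet_Ioi fun u hu => ?_
  have hu0 : 0 < u := ht₀.trans hu
  have hpos : 0 < 1 - (b₁ - ν) / a / u ^ 2 := by
    have : (b₁ - ν) / a / u ^ 2 < 0 :=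
      div_neg_of_neg_of_pos (div_neg_of_neg_of_pos (by linarith) ha) (by positivity)
    linarith
  have hfac : 1 + (a * u ^ 2 - b₁) / ν = ν⁻¹ * (a * (u ^ 2 * (1 - (b₁ - ν) / a / u ^ 2))) := by
    field_simp
    ring
  have hsq : u ^ j * (u ^ 2) ^ (-s) = u ^ (-2 * b - 1) := by
    rw [← Real.rpow_natCast u j, ← Real.rpow_natCast u 2, ← Real.rpow_mul hu0.le,
      ← Real.rpow_add hu0]
    congr 1
    rw [hb_def, hs]
    push_cast
    ring
  change u ^ j * (1 + (a * u ^ 2 - b₁) / ν) ^ (-s) = _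
  rw [hfac, Real.mul_rpow (by positivity) (by positivity), Real.mul_rpow ha.le (by positivity),
    Real.mul_rpow (by positivity) hpos.le, Real.inv_rpow hν.le, Real.rpow_neg hν.le, inv_inv,
    ← hsq]
  ring
end

section
/- Let g : ℝ → ℝ be continuous and everywhere strictly positive, and suppose z ↦ g(‖z‖²) is Lebesgue integrable on ℝⁿ with total integral M = ∫_{ℝⁿ} g(‖z‖²) dz > 0. Let D be a symmetric positive definite real n×n matrix and v ∈ ℝⁿ. Define T : [0, ∞) → ℝ by T(R) = ∫_{{u ∈ ℝⁿ : uᵗ D u ≥ R²}} g(‖u − v‖²) du. Then T is continuous and strictly decreasing on [0, ∞), T(0) = M, and T(R) → 0 as R → ∞; consequently, for every c with 0 < c < M there exists a unique R > 0 such that T(R) = c. -/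
open MeasureTheory Matrix
open scoped RealInnerProductSpace

section TailIntegral

open Set Filter Topology Pointwise

variable {E : Type*} [NormedAddCommGroup E] [NormedSpace ℝ E] [FiniteDimensional ℝ E]
  [MeasurableSpace E] [BorelSpace E] (μ : Measure E) [μ.IsAddHaarMeasure]
  {q f : E → ℝ}

/-- The level sets of a continuous positive definite function that is homogeneous of degree two
are Lebesgue null. -/
theorem measure_level_set_eq_zero [Nontrivial E] (hqc : Continuous q)
    (hqh : ∀ (t : ℝ) u, q (t • u) = t ^ 2 * q u) (hqp : ∀ u, u ≠ 0 → 0 < q u) (R : ℝ) :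
    μ {u | q u = R ^ 2} = 0 := by
  rcases eq_or_ne R 0 with rfl | hR
  · refine measure_mono_null (t := {0}) (fun u hu => ?_) (measure_singleton 0)
    by_contra h
    have := hqp u h
    simp only [mem_ofPred_eq] at hu
    simp [hu] at this
  have hcount : Set.Countable {c : ℝ | 0 < μ {u | q u = c}} :=
    Measure.countable_meas_level_set_pos hqc.measurable
  by_contra h
  have hsub : Ioi (0 : ℝ) ⊆ {c : ℝ | 0 < μ {u | q u = c}} := by
    intro c hc
    have hc : 0 < c := hc
    have hle : (√c / R) • {u | q u = R ^ 2} ⊆ {u | q u = c} := by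
      rintro _ ⟨u, hu, rfl⟩
      simp only [mem_ofPred_eq] at hu ⊢
      rw [hqh, hu, div_pow, Real.sq_sqrt hc.le]
      field_simp
    refine lt_of_lt_of_le ?_ (measure_mono hle)
    rw [Measure.addHaar_smul]
    refine ENNReal.mul_pos ?_ h
    simp [(Real.sqrt_pos.2 hc).ne', hR]
  exact absurd (Cardinal.Real.Ioo_countable_iff.1 (hcount.mono (Ioo_subset_Ioi_self.trans hsub)))
    (not_le.2 (zero_lt_one (α := ℝ)))

omit [NormedSpace ℝ E] [FiniteDimensional ℝ E] [μ.IsAddHaarMeasure] in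
theorem continuous_setIntegral_superlevel (hf : Integrable f μ) (hqc : Continuous q)
    (hnull : ∀ R : ℝ, μ {u | q u = R ^ 2} = 0) :
    Continuous fun R : ℝ => ∫ u in {u | R ^ 2 ≤ q u}, f u ∂μ := by
  have hmeas : ∀ R : ℝ, MeasurableSet {u | R ^ 2 ≤ q u} := fun R =>
    measurableSet_le measurable_const hqc.measurable
  simp_rw [← fun R => integral_indicator (f := f) (μ := μ) (hmeas R)]
  refine continuous_iff_continuousAt.2 fun R => ?_
  refine continuousAt_of_dominated (bound := fun u => ‖f u‖)
    (.of_forall fun r => (hf.indicator (hmeas r)).aestronglyMeasurable)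
    (.of_forall fun r => .of_forall fun u => norm_indicator_le_norm_self _ _) hf.norm ?_
  have hae : ∀ᵐ u ∂μ, q u ≠ R ^ 2 := by
    simpa [ae_iff] using hnull R
  filter_upwards [hae] with u hu
  rcases lt_or_gt_of_ne hu with h | h
  · have hev : ∀ᶠ r : ℝ in 𝓝 R, q u < r ^ 2 :=
      (continuous_pow 2).continuousAt.eventually_const_lt h
    refine (continuousAt_const (y := (0 : ℝ))).congr ?_
    filter_upwards [hev] with r hr
    rw [indicator_of_notMem]
    simpa using hr
  · have hev : ∀ᶠ r : ℝ in 𝓝 R, r ^ 2 < q u :=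
      (continuous_pow 2).continuousAt.eventually_lt_const h
    refine (continuousAt_const (y := f u)).congr ?_
    filter_upwards [hev] with r hr
    rw [indicator_of_mem]
    exact hr.le

omit [NormedSpace ℝ E] [FiniteDimensional ℝ E] [μ.IsAddHaarMeasure] in
theorem tendsto_setIntegral_superlevel_atTop (hf : Integrable f μ) (hqc : Continuous q) :
    Tendsto (fun R : ℝ => ∫ u in {u | R ^ 2 ≤ q u}, f u ∂μ) atTop (𝓝 0) := by
  have hmeas : ∀ R : ℝ, MeasurableSet {u | R ^ 2 ≤ q u} := fun R =>
    measurableSet_le measurable_const hqc.measurable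
  simp_rw [← fun R => integral_indicator (f := f) (μ := μ) (hmeas R)]
  rw [← integral_zero E ℝ (μ := μ)]
  refine tendsto_integral_filter_of_dominated_convergence (fun u => ‖f u‖)
    (.of_forall fun r => (hf.indicator (hmeas r)).aestronglyMeasurable)
    (.of_forall fun r => .of_forall fun u => norm_indicator_le_norm_self _ _) hf.norm
    (.of_forall fun u => ?_)
  refine tendsto_const_nhds.congr' ?_
  filter_upwards [(tendsto_pow_atTop two_ne_zero).eventually_gt_atTop (q u)] with r hr
  rw [indicator_of_notMem]
  simpa using hr

omit [FiniteDimensional ℝ E] in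
theorem strictAntiOn_setIntegral_superlevel [Nontrivial E] (hf : Integrable f μ)
    (hqc : Continuous q) (hfp : ∀ u, 0 < f u)
    (hqh : ∀ (t : ℝ) u, q (t • u) = t ^ 2 * q u) (hqp : ∀ u, u ≠ 0 → 0 < q u) :
    StrictAntiOn (fun R : ℝ => ∫ u in {u | R ^ 2 ≤ q u}, f u ∂μ) (Ici 0) := by
  intro a ha b _ hab
  have ha : 0 ≤ a := ha
  have hsq : a ^ 2 < b ^ 2 := by gcongr
  have hmeas : MeasurableSet {u | b ^ 2 ≤ q u} :=
    measurableSet_le measurable_const hqc.measurable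
  have hsub : {u | b ^ 2 ≤ q u} ⊆ {u | a ^ 2 ≤ q u} := fun u hu => hsq.le.trans hu
  have hpos : 0 < ∫ u in {u | a ^ 2 ≤ q u} \ {u | b ^ 2 ≤ q u}, f u ∂μ := by
    rw [setIntegral_pos_iff_support_of_nonneg_ae (.of_forall fun u => (hfp u).le)
      hf.integrableOn]
    have hopen : IsOpen {u | a ^ 2 < q u ∧ q u < b ^ 2} :=
      (isOpen_lt continuous_const hqc).inter (isOpen_lt hqc continuous_const)
    have hne : {u | a ^ 2 < q u ∧ q u < b ^ 2}.Nonempty := by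
      obtain ⟨w, hw⟩ := exists_ne (0 : E)
      obtain ⟨c, hac, hcb⟩ := exists_between hsq
      have hc : 0 ≤ c / q w := div_nonneg ((sq_nonneg a).trans hac.le) (hqp w hw).le
      refine ⟨√(c / q w) • w, ?_⟩
      simp only [mem_ofPred_eq, hqh, Real.sq_sqrt hc, div_mul_cancel₀ c (hqp w hw).ne']
      exact ⟨hac, hcb⟩
    refine (hopen.measure_pos μ hne).trans_le (measure_mono fun u hu => ?_)
    exact ⟨(hfp u).ne', hu.1.le, not_le.2 hu.2⟩
  rw [setIntegral_sdiff hmeas hf.integrableOn hsub] at hpos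
  exact sub_pos.1 hpos

end TailIntegral

/-- existence and uniqueness of the VaR radius.  For a continuous,
strictly positive g with z ↦ g(‖z‖²) Lebesgue integrable on ℝⁿ of total integral M > 0,
a symmetric positive definite D and v ∈ ℝⁿ, the tail function
T(R) = ∫_{uᵗDu ≥ R²} g(‖u−v‖²) du is continuous and strictly decreasing on [0, ∞),
T(0) = M, T(R) → 0 as R → ∞, and for every 0 < c < M there is a unique R > 0 with
T(R) = c.  The quadratic form is uᵗDu = ⟪u, Du⟫. -/
theorem var_radius_exists_unique
    (n : ℕ) (hn : 1 ≤ n) (g : ℝ → ℝ) (hgc : Continuous g) (hgpos : ∀ x, 0 < g x)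
    (hint : Integrable (fun z : EuclideanSpace ℝ (Fin n) => g (‖z‖ ^ 2)))
    (hM : 0 < ∫ z : EuclideanSpace ℝ (Fin n), g (‖z‖ ^ 2))
    (D : Matrix (Fin n) (Fin n) ℝ) (hD : D.PosDef) (v : EuclideanSpace ℝ (Fin n))
    (T : ℝ → ℝ)
    (hT : ∀ R : ℝ, T R = ∫ u in {u : EuclideanSpace ℝ (Fin n) |
        R ^ 2 ≤ ⟪u, Matrix.toEuclideanLin D u⟫}, g (‖u - v‖ ^ 2)) :
    ContinuousOn T (Set.Ici 0) ∧
    StrictAntiOn T (Set.Ici 0) ∧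
    (T 0 = ∫ z : EuclideanSpace ℝ (Fin n), g (‖z‖ ^ 2)) ∧
    Filter.Tendsto T Filter.atTop (nhds 0) ∧
    (∀ c : ℝ, 0 < c → (c < ∫ z : EuclideanSpace ℝ (Fin n), g (‖z‖ ^ 2)) →
      ∃! R : ℝ, 0 < R ∧ T R = c) := by
  have : NeZero n := ⟨by omega⟩
  set q : EuclideanSpace ℝ (Fin n) → ℝ := fun u => ⟪u, Matrix.toEuclideanLin D u⟫ with hq
  have hqc : Continuous q :=
    continuous_id.inner (Matrix.toEuclideanLin D).continuous_of_finiteDimensional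
  have hqh : ∀ (t : ℝ) u, q (t • u) = t ^ 2 * q u := fun t u => by
    simp only [hq, map_smul, real_inner_smul_left, real_inner_smul_right]
    ring
  have hqp : ∀ u, u ≠ 0 → 0 < q u := fun u hu => by
    have hu' : u.ofLp ≠ 0 := fun h => hu (by ext i; simp [h])
    have := hD.dotProduct_mulVec_pos hu'
    simpa [hq, EuclideanSpace.inner_eq_star_dotProduct, Matrix.toLpLin_apply,
      dotProduct_comm] using this
  have hf : Integrable fun u : EuclideanSpace ℝ (Fin n) => g (‖u - v‖ ^ 2) :=
    hint.comp_sub_right v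
  obtain rfl : T = fun R : ℝ => ∫ u in {u | R ^ 2 ≤ q u}, g (‖u - v‖ ^ 2) := funext hT
  have hcont := continuous_setIntegral_superlevel volume hf hqc
    (measure_level_set_eq_zero volume hqc hqh hqp)
  have hanti := strictAntiOn_setIntegral_superlevel volume hf hqc (fun _ => hgpos _) hqh hqp
  have hlim := tendsto_setIntegral_superlevel_atTop volume hf hqc
  set T : ℝ → ℝ := fun R => ∫ u in {u | R ^ 2 ≤ q u}, g (‖u - v‖ ^ 2)
  have hzero : T 0 = ∫ z : EuclideanSpace ℝ (Fin n), g (‖z‖ ^ 2) := by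
    have huniv : {u | (0 : ℝ) ^ 2 ≤ q u} = Set.univ := by
      refine Set.eq_univ_of_forall fun u => ?_
      rcases eq_or_ne u 0 with rfl | hu
      · simp [hq]
      · simpa using (hqp u hu).le
    simp only [T, huniv, setIntegral_univ]
    exact integral_sub_right_eq_self (fun z : EuclideanSpace ℝ (Fin n) => g (‖z‖ ^ 2)) v
  refine ⟨hcont.continuousOn, hanti, hzero, hlim, fun c hc hcM => ?_⟩
  rw [← hzero] at hcM
  obtain ⟨b, hbc, hb⟩ :=
    ((hlim.eventually_lt_const hc).and (Filter.eventually_ge_atTop (0 : ℝ))).exists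
  obtain ⟨R, hR, hRc⟩ := intermediate_value_Icc' hb hcont.continuousOn ⟨hbc.le, hcM.le⟩
  refine ⟨R, ⟨hR.1.lt_of_ne ?_, hRc⟩, fun S hS => ?_⟩
  · rintro rfl
    exact hcM.ne' hRc
  · exact hanti.injOn hS.1.le hR.1 (hS.2.trans hRc.symm)
end
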